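/- Let K be an infinite field and n, t positive integers with t ≤ n(n−1)/2, and assume that t ≥ 2 or n is even. Then there exists a nonzero polynomial P in the t·n² variables X_{r,i,j} (r = 1,…,t; i,j = 1,…,n) with coefficients in K such that: for every t-tuple (φ₁,…,φ_t) of linearly independent alternating bilinear forms on K^n for which there exists a nonzero vector c ∈ K^n with φ_r(c, y) = 0 for all y ∈ K^n and all r (equivalently, for which the center of L(Φ) is strictly larger than its commutator ideal), P vanishes at the point (φ_r(e_i, e_j))_{r,i,j}, where e₁,…,e_n is the standard basis of K^n. (That is, a generic 2-step nilpotent Lie algebra L of 𝔑₂(n,t) satisfies Z(L) = [L,L] in this case.) -/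

import Mathlib

/-- A `t`-tuple of alternating bilinear forms on `K^n`. -/
structure AltTuple (K : Type) [Field K] (n t : ℕ) : Type where
  φ : Fin t → LinearMap.BilinForm K (Fin n → K)
  alt : ∀ r, (φ r).IsAlt

namespace AltTuple

variable {K : Type} [Field K] {n t : ℕ}

/-- The underlying vector space `K^n × K^t` of the 2-step nilpotent Lie algebra `L(Φ)`. -/
def L (Φ : AltTuple K n t) : Type := (Fin n → K) × (Fin t → K)

instance (Φ : AltTuple K n t) : AddCommGroup Φ.L :=
  inferInstanceAs (AddCommGroup ((Fin n → K) × (Fin t → K)))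

instance (Φ : AltTuple K n t) : Module K Φ.L :=
  inferInstanceAs (Module K ((Fin n → K) × (Fin t → K)))

/-- The Lie ring structure on `L(Φ)`:
`⁅(x,a),(y,b)⁆ = (0, (φ₁(x,y),…,φ_t(x,y)))`. -/
instance (Φ : AltTuple K n t) : LieRing Φ.L where
  bracket x y := ((0 : Fin n → K), fun r => Φ.φ r x.1 y.1)
  add_lie x y z := by
    show ((0 : Fin n → K), fun r => Φ.φ r (x.1 + y.1) z.1)
        = (((0 : Fin n → K), fun r => Φ.φ r x.1 z.1)
            + ((0 : Fin n → K), fun r => Φ.φ r y.1 z.1) : (Fin n → K) × (Fin t → K))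
    refine Prod.ext (by simp) ?_
    funext r
    simp [map_add]
  lie_add x y z := by
    show ((0 : Fin n → K), fun r => Φ.φ r x.1 (y.1 + z.1))
        = (((0 : Fin n → K), fun r => Φ.φ r x.1 y.1)
            + ((0 : Fin n → K), fun r => Φ.φ r x.1 z.1) : (Fin n → K) × (Fin t → K))
    refine Prod.ext (by simp) ?_
    funext r
    simp [map_add]
  lie_self x := by
    show ((0 : Fin n → K), fun r => Φ.φ r x.1 x.1) = ((0, 0) : (Fin n → K) × (Fin t → K))
    refine Prod.ext rfl ?_
    funext r
    exact Φ.alt r x.1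
  leibniz_lie x y z := by
    show ((0 : Fin n → K), fun r => Φ.φ r x.1 (0 : Fin n → K))
        = (((0 : Fin n → K), fun r => Φ.φ r (0 : Fin n → K) z.1)
            + ((0 : Fin n → K), fun r => Φ.φ r y.1 (0 : Fin n → K)) : (Fin n → K) × (Fin t → K))
    refine Prod.ext (by simp) ?_
    funext r
    simp

instance (Φ : AltTuple K n t) : LieAlgebra K Φ.L where
  lie_smul c x y := by
    show ((0 : Fin n → K), fun r => Φ.φ r x.1 (c • y.1))
        = (c • (((0 : Fin n → K), fun r => Φ.φ r x.1 y.1) : (Fin n → K) × (Fin t → K)))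
    refine Prod.ext (by simp) ?_
    funext r
    simp

/-- The point of `K^{t·n²}` recording the matrix entries `φ_r(e_i,e_j)` of the forms. -/
def evalPoint (Φ : AltTuple K n t) : Fin t × Fin n × Fin n → K :=
  fun p => Φ.φ p.1 (Pi.single p.2.1 1) (Pi.single p.2.2 1)

end AltTuple

/-- The determinant of the `n × n` matrix whose `i`-th row is the row `(s i).2` of the Gram matrix
of the form `(s i).1`. -/
noncomputable def rowSelectionDet (K : Type) [Field K] {n t : ℕ} (s : Fin n → Fin t × Fin n) :
    MvPolynomial (Fin t × Fin n × Fin n) K :=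
  (Matrix.of fun i j => MvPolynomial.X ((s i).1, (s i).2, j)).det

namespace AltTuple

variable {K : Type} [Field K] {n t : ℕ}

theorem eval_rowSelectionDet (Φ : AltTuple K n t) (s : Fin n → Fin t × Fin n) :
    MvPolynomial.eval Φ.evalPoint (rowSelectionDet K s) =
      (Matrix.of fun i j => Φ.evalPoint ((s i).1, (s i).2, j)).det := by
  rw [rowSelectionDet, RingHom.map_det]
  congr 1
  ext i j
  simp

theorem mulVec_rowSelection (Φ : AltTuple K n t) (s : Fin n → Fin t × Fin n) (v : Fin n → K)
    (i : Fin n) :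
    (Matrix.of fun i j => Φ.evalPoint ((s i).1, (s i).2, j)).mulVec v i =
      Φ.φ (s i).1 (Pi.single (s i).2 1) v := by
  conv_rhs => rw [pi_eq_sum_univ' v]
  simp only [Matrix.mulVec, dotProduct, Matrix.of_apply, evalPoint, map_sum, map_smul,
    smul_eq_mul]
  refine Finset.sum_congr rfl fun j _ => ?_
  rw [mul_comm]

theorem eval_rowSelectionDet_eq_zero (Φ : AltTuple K n t) (s : Fin n → Fin t × Fin n)
    {c : Fin n → K} (hc : c ≠ 0) (h : ∀ r y, Φ.φ r c y = 0) :
    MvPolynomial.eval Φ.evalPoint (rowSelectionDet K s) = 0 := by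
  rw [eval_rowSelectionDet, ← Matrix.exists_mulVec_eq_zero_iff]
  refine ⟨c, hc, funext fun i => ?_⟩
  rw [mulVec_rowSelection, ← LinearMap.BilinForm.IsAlt.neg_eq (Φ.alt _), h, neg_zero, Pi.zero_apply]

theorem eval_rowSelectionDet_ne_zero (Φ : AltTuple K n t) (s : Fin n → Fin t × Fin n)
    (h : ∀ v, (∀ i, Φ.φ (s i).1 (Pi.single (s i).2 1) v = 0) → v = 0) :
    MvPolynomial.eval Φ.evalPoint (rowSelectionDet K s) ≠ 0 := by
  rw [eval_rowSelectionDet, Ne, ← Matrix.exists_mulVec_eq_zero_iff]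
  rintro ⟨v, hv, hv0⟩
  exact hv (h v fun i => by rw [← mulVec_rowSelection, hv0, Pi.zero_apply])

/-- The alternating form with Gram matrix `B - Bᵀ`. -/
noncomputable def skewForm (B : Matrix (Fin n) (Fin n) K) : LinearMap.BilinForm K (Fin n → K) :=
  Matrix.toBilin' B - (Matrix.toBilin' B).flip

theorem skewForm_isAlt (B : Matrix (Fin n) (Fin n) K) : (skewForm B).IsAlt := fun x => by
  simp [skewForm]

theorem skewForm_single (B : Matrix (Fin n) (Fin n) K) (i : Fin n) (v : Fin n → K) :
    skewForm B (Pi.single i 1) v = ∑ j, (B i j - B j i) * v j := by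
  simp only [skewForm, LinearMap.sub_apply, LinearMap.BilinForm.flip_apply,
    Matrix.toBilin'_apply', single_one_dotProduct, Matrix.mulVec_single_one]
  simp only [Matrix.mulVec, dotProduct, Matrix.col_apply, sub_mul, Finset.sum_sub_distrib]
  simp only [mul_comm]

/-- The form pairing the coordinates `2k` and `2k + 1`. -/
noncomputable def pairingForm (K : Type) [Field K] (n : ℕ) : LinearMap.BilinForm K (Fin n → K) :=
  skewForm (Matrix.of fun i j => if Even (i : ℕ) ∧ (j : ℕ) = i + 1 then 1 else 0)

theorem pairingForm_single_of_even {i j : Fin n} (hi : Even (i : ℕ)) (hj : (j : ℕ) = i + 1)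
    (v : Fin n → K) : pairingForm K n (Pi.single i 1) v = v j := by
  rw [pairingForm, skewForm_single, Finset.sum_eq_single j]
  · have h : ¬ ((i : ℕ) = j + 1) := by omega
    simp only [Matrix.of_apply, h, and_false, if_false, if_pos (And.intro hi hj), sub_zero, one_mul]
  · intro k _ hk
    have h₁ : (k : ℕ) ≠ i + 1 := fun h => hk (Fin.ext (h.trans hj.symm))
    have h₂ : ¬ (Even (k : ℕ) ∧ (i : ℕ) = k + 1) := by grind
    simp [h₁, h₂]
  · simp

theorem pairingForm_single_of_odd {i j : Fin n} (hj : Even (j : ℕ)) (hi : (i : ℕ) = j + 1)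
    (v : Fin n → K) : pairingForm K n (Pi.single i 1) v = -v j := by
  rw [pairingForm, skewForm_single, Finset.sum_eq_single j]
  · have h : ¬ ((j : ℕ) = i + 1) := by omega
    simp only [Matrix.of_apply, h, and_false, if_false, if_pos (And.intro hj hi), zero_sub, neg_mul,
      one_mul]
  · intro k _ hk
    have h₁ : ¬ (Even (k : ℕ) ∧ (i : ℕ) = k + 1) := fun h => hk (Fin.ext (by omega))
    have h₂ : ¬ (Even (i : ℕ) ∧ (k : ℕ) = i + 1) := by grind
    simp only [Matrix.of_apply, h₁, h₂, if_false, sub_zero, zero_mul]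
  · simp

/-- The form pairing the coordinates `a` and `b`. -/
noncomputable def edgeForm (K : Type) [Field K] (a b : Fin n) :
    LinearMap.BilinForm K (Fin n → K) :=
  skewForm (Matrix.single a b 1)

theorem edgeForm_single {a b : Fin n} (hab : a ≠ b) (v : Fin n → K) :
    edgeForm K a b (Pi.single a 1) v = v b := by
  rw [edgeForm, skewForm_single, Finset.sum_eq_single b]
  · simp [hab.symm]
  · intro k _ hk
    simp [hk.symm, hab.symm]
  · simp

theorem eq_zero_of_pairingForm_single_eq_zero {v : Fin n → K} {j : Fin n}
    (hj : Odd (j : ℕ) ∨ (j : ℕ) + 1 < n)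
    (h : ∀ i : Fin n, Odd (i : ℕ) ∨ (i : ℕ) + 1 < n → pairingForm K n (Pi.single i 1) v = 0) :
    v j = 0 := by
  rcases Nat.even_or_odd (j : ℕ) with he | ho
  · have hlt : (j : ℕ) + 1 < n := hj.resolve_left (Nat.not_odd_iff_even.mpr he)
    have := h ⟨j + 1, hlt⟩ (Or.inl he.add_one)
    rwa [pairingForm_single_of_odd he rfl, neg_eq_zero] at this
  · obtain ⟨k, hk⟩ := ho
    have := h ⟨2 * k, by omega⟩ (Or.inr (by simp only; omega))
    rwa [pairingForm_single_of_even (j := j) (by simp) (by simp [hk])] at this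

/-- Some row selection determinant is nonzero at some alternating tuple. In particular it does not
vanish for the trivial reason that the Gram matrices are alternating. -/
theorem exists_eval_rowSelectionDet_ne_zero (K : Type) [Field K] {n t : ℕ} (ht : 0 < t)
    (hcase : 2 ≤ t ∧ n ≠ 1 ∨ Even n) :
    ∃ (s : Fin n → Fin t × Fin n) (Φ : AltTuple K n t),
      MvPolynomial.eval Φ.evalPoint (rowSelectionDet K s) ≠ 0 := by
  rcases Nat.even_or_odd n with hn | hn
  · refine ⟨fun i => (⟨0, ht⟩, i), ⟨fun _ => pairingForm K n, fun _ => skewForm_isAlt _⟩,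
      eval_rowSelectionDet_ne_zero _ _ fun v hv => funext fun j =>
        eq_zero_of_pairingForm_single_eq_zero ?_ fun i _ => hv i⟩
    have := j.isLt
    grind
  · obtain ⟨ht₂, hn₁⟩ := hcase.resolve_right (Nat.not_even_iff_odd.mpr hn)
    have hn₃ : 3 ≤ n := by grind
    let a : Fin n := ⟨0, by omega⟩
    let b : Fin n := ⟨n - 1, by omega⟩
    have hab : a ≠ b := by simp only [a, b, ne_eq, Fin.mk.injEq]; omega
    refine ⟨fun i => if i = b then (⟨1, ht₂⟩, a) else (⟨0, ht⟩, i),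
      ⟨fun r => if (r : ℕ) = 0 then pairingForm K n else edgeForm K a b, fun r => ?_⟩,
      eval_rowSelectionDet_ne_zero _ _ fun v hv => funext fun j => ?_⟩
    · split_ifs <;> exact skewForm_isAlt _
    · by_cases hj : j = b
      · have := hv b
        simp only [if_true, one_ne_zero, if_false, edgeForm_single hab] at this
        rw [hj, this, Pi.zero_apply]
      · refine eq_zero_of_pairingForm_single_eq_zero (Or.inr ?_) fun i hi => ?_
        · have : (j : ℕ) ≠ n - 1 := fun h => hj (Fin.ext h)
          omega
        · have hib : i ≠ b := by
            rintro rfl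
            simp only [b] at hi
            grind
          simpa [hib] using hv i

end AltTuple

/-- For K infinite, t ≤ n(n−1)/2, and (t ≥ 2 or n even), there is a nonzero
polynomial in the matrix entries of the forms vanishing at every linearly independent
tuple Φ whose Lie algebra L(Φ) has center strictly larger than its commutator ideal,
i.e. admitting a nonzero common radical vector. -/
theorem generic_center_eq_commutator
    (K : Type) [Field K] [Infinite K] (n t : ℕ) (hn : 0 < n) (ht : 0 < t)
    (htop : 2 * t ≤ n * (n - 1)) (hcase : 2 ≤ t ∨ Even n) :
    ∃ P : MvPolynomial (Fin t × Fin n × Fin n) K, P ≠ 0 ∧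
      ∀ Φ : AltTuple K n t, LinearIndependent K Φ.φ →
        (∃ c : Fin n → K, c ≠ 0 ∧ ∀ (r : Fin t) (y : Fin n → K), Φ.φ r c y = 0) →
        MvPolynomial.eval Φ.evalPoint P = 0 := by
  have hn₁ : n ≠ 1 := by rintro rfl; omega
  obtain ⟨s, Φ₀, h₀⟩ := AltTuple.exists_eval_rowSelectionDet_ne_zero K ht
    (hcase.imp_left fun h => ⟨h, hn₁⟩)
  refine ⟨rowSelectionDet K s, ?_, ?_⟩
  · intro h
    simp [h] at h₀
  · rintro Φ - ⟨c, hc, h⟩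
    exact Φ.eval_rowSelectionDet_eq_zero s hc h
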